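/- For every complex q with 0 < |q| < 1, σ₂(q) = (1/(-q;q)_∞) · { 1 − ∑_{n=1}^{∞} [ (-1)^n q^{n(5n-1)/2} (1 + q^{2n}) / (1 − q^n) ] · ∑_{m=0}^{n-1} [ (-1;q)_m / (q;q)_m ] (-q^{-n})^m }. -/

import Mathlib

open scoped BigOperators

/-- The finite q-Pochhammer symbol `(a;q)_n`. -/
noncomputable def qPoch (a q : ℂ) (n : ℕ) : ℂ := ∏ k ∈ Finset.range n, (1 - a * q ^ k)

/-- The infinite q-Pochhammer symbol `(a;q)_∞`. -/
noncomputable def qPochInf (a q : ℂ) : ℂ := ∏' k : ℕ, (1 - a * q ^ k)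

/-- The rank parity function `σ₂(q)` associated to Rogers–Ramanujan partitions. -/
noncomputable def sigma2 (q : ℂ) : ℂ := ∑' n : ℕ, (-1) ^ n * q ^ (n ^ 2) / qPoch (-q) q n

open Filter Topology Finset

theorem qPoch_zero (a q : ℂ) : qPoch a q 0 = 1 := by simp [qPoch]

theorem qPoch_succ (a q : ℂ) (n : ℕ) : qPoch a q (n + 1) = qPoch a q n * (1 - a * q ^ n) := by
  simp [qPoch, prod_range_succ]

theorem qPoch_succ' (a q : ℂ) (n : ℕ) : qPoch a q (n + 1) = (1 - a) * qPoch (a * q) q n := by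
  simp only [qPoch, prod_range_succ', pow_zero, mul_one, pow_succ']
  rw [mul_comm]
  simp only [mul_assoc]

theorem qPoch_add (a q : ℂ) (m n : ℕ) :
    qPoch a q (m + n) = qPoch a q m * qPoch (a * q ^ m) q n := by
  simp only [qPoch, prod_range_add, pow_add, mul_assoc]

theorem norm_qPoch_le {a q : ℂ} (ha : ‖a‖ ≤ 1) (hq : ‖q‖ < 1) (n : ℕ) :
    ‖qPoch a q n‖ ≤ Real.exp (1 - ‖q‖)⁻¹ := by
  rw [qPoch, norm_prod]
  calc ∏ k ∈ range n, ‖1 - a * q ^ k‖ ≤ ∏ k ∈ range n, Real.exp (‖q‖ ^ k) := by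
        refine prod_le_prod (fun _ _ => norm_nonneg _) fun k _ => ?_
        calc ‖1 - a * q ^ k‖ ≤ ‖(1 : ℂ)‖ + ‖a * q ^ k‖ := norm_sub_le _ _
          _ ≤ ‖q‖ ^ k + 1 := by
            rw [norm_one, norm_mul, norm_pow]
            nlinarith [pow_nonneg (norm_nonneg q) k]
          _ ≤ _ := Real.add_one_le_exp _
    _ = Real.exp (∑ k ∈ range n, ‖q‖ ^ k) := (Real.exp_sum _ _).symm
    _ ≤ _ := by
        rw [Real.exp_le_exp, ← tsum_geometric_of_lt_one (norm_nonneg q) hq]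
        exact (summable_geometric_of_lt_one (norm_nonneg q) hq).sum_le_tsum _
          fun _ _ => by positivity

theorem summable_norm_mul_pow {q : ℂ} (a : ℂ) (hq : ‖q‖ < 1) :
    Summable fun k : ℕ => ‖-(a * q ^ k)‖ := by
  simp only [norm_neg, norm_mul, norm_pow]
  exact (summable_geometric_of_lt_one (norm_nonneg q) hq).mul_left _

theorem tendsto_qPoch {q : ℂ} (a : ℂ) (hq : ‖q‖ < 1) :
    Tendsto (qPoch a q) atTop (𝓝 (qPochInf a q)) := by
  have h := (multipliable_one_add_of_summable (summable_norm_mul_pow a hq)).hasProd.tendsto_prod_nat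
  simp only [← sub_eq_add_neg] at h
  exact h

theorem qPochInf_ne_zero {a q : ℂ} (hq : ‖q‖ < 1) (h : ∀ k : ℕ, 1 - a * q ^ k ≠ 0) :
    qPochInf a q ≠ 0 := by
  have := tprod_one_add_ne_zero_of_summable (f := fun k : ℕ => -(a * q ^ k))
    (fun k => by simpa only [← sub_eq_add_neg] using h k) (summable_norm_mul_pow a hq)
  simp only [← sub_eq_add_neg] at this
  exact this

theorem qPochInf_eq_qPoch_mul {q : ℂ} (a : ℂ) (hq : ‖q‖ < 1) (m : ℕ) :
    qPochInf a q = qPoch a q m * qPochInf (a * q ^ m) q := by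
  have h := (tendsto_qPoch a hq).comp (tendsto_add_atTop_nat m)
  have h' := (tendsto_qPoch (a * q ^ m) hq).const_mul (qPoch a q m)
  refine tendsto_nhds_unique h (h'.congr fun n => ?_)
  rw [Function.comp, add_comm n m, qPoch_add]

theorem exists_norm_inv_qPoch_le {a q : ℂ} (hq : ‖q‖ < 1) (h : ∀ k : ℕ, 1 - a * q ^ k ≠ 0) :
    ∃ C : ℝ, 0 ≤ C ∧ ∀ n, ‖(qPoch a q n)⁻¹‖ ≤ C := by
  obtain ⟨C, hC⟩ := ((tendsto_qPoch a hq).inv₀ (qPochInf_ne_zero hq h)).norm.bddAbove_range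
  exact ⟨C, (norm_nonneg _).trans (hC ⟨0, rfl⟩), fun n => hC ⟨n, rfl⟩⟩

theorem one_sub_pow_succ_ne_zero {q : ℂ} (hq : ‖q‖ < 1) (n : ℕ) : 1 - q ^ (n + 1) ≠ 0 := by
  intro h
  have h1 : ‖q ^ (n + 1)‖ = 1 := by rw [← sub_eq_zero.mp h, norm_one]
  rw [norm_pow] at h1
  exact (pow_lt_one₀ (norm_nonneg q) hq n.succ_ne_zero).ne h1

theorem one_add_pow_ne_zero {q : ℂ} (hq : ‖q‖ < 1) (n : ℕ) : 1 + q ^ n ≠ 0 := by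
  rcases n with _ | n
  · norm_num
  · intro h
    have h1 : ‖q ^ (n + 1)‖ = 1 := by rw [eq_neg_of_add_eq_zero_right h, norm_neg, norm_one]
    rw [norm_pow] at h1
    exact (pow_lt_one₀ (norm_nonneg q) hq n.succ_ne_zero).ne h1

theorem one_sub_neg_one_mul_pow_ne_zero {q : ℂ} (hq : ‖q‖ < 1) (n : ℕ) :
    1 - -1 * q ^ n ≠ 0 := by
  simpa using one_add_pow_ne_zero hq n

theorem one_sub_self_mul_pow_ne_zero {q : ℂ} (hq : ‖q‖ < 1) (n : ℕ) :
    1 - q * q ^ n ≠ 0 := by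
  simpa [pow_succ'] using one_sub_pow_succ_ne_zero hq n

theorem qPoch_ne_zero {a q : ℂ} (h : ∀ k : ℕ, 1 - a * q ^ k ≠ 0) (n : ℕ) : qPoch a q n ≠ 0 :=
  prod_ne_zero_iff.mpr fun k _ => h k

theorem pow_choose_two_succ (q : ℂ) (k : ℕ) :
    q ^ (k + 1).choose 2 = q ^ k * q ^ k.choose 2 := by
  rw [Nat.choose_succ_succ' k 1, Nat.choose_one_right, pow_add]

/-- The `k`-th term of Sylvester's expansion of `(A;q)_∞`. -/
noncomputable def sylvesterTerm (A q : ℂ) (k : ℕ) : ℂ :=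
  (1 - A * q ^ (2 * k)) * qPoch A q k * (-A) ^ k * q ^ (k ^ 2 + k.choose 2) / qPoch q q k

theorem exists_norm_sylvester_le {q : ℂ} (hq : ‖q‖ < 1) :
    ∃ C : ℝ, 0 ≤ C ∧ ∀ A : ℂ, ‖A‖ ≤ 1 → ∀ k,
      ‖qPoch A q k * (-A) ^ k * q ^ (k ^ 2 + k.choose 2) / qPoch q q k‖ ≤ C * ‖q‖ ^ k := by
  obtain ⟨D, hD0, hD⟩ := exists_norm_inv_qPoch_le hq (one_sub_self_mul_pow_ne_zero hq)
  refine ⟨Real.exp (1 - ‖q‖)⁻¹ * D, by positivity, fun A hA k => ?_⟩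
  rw [div_eq_mul_inv, norm_mul, norm_mul, norm_mul, norm_pow, norm_pow, norm_neg]
  have h1 := norm_qPoch_le hA hq k
  have h2 : ‖A‖ ^ k ≤ 1 := pow_le_one₀ (norm_nonneg _) hA
  have h3 : ‖q‖ ^ (k ^ 2 + k.choose 2) ≤ ‖q‖ ^ k :=
    pow_le_pow_of_le_one (norm_nonneg _) hq.le (by nlinarith [Nat.le_self_pow two_ne_zero k])
  calc _ ≤ Real.exp (1 - ‖q‖)⁻¹ * 1 * ‖q‖ ^ k * D := by gcongr; exact hD k
    _ = _ := by ring

theorem norm_one_sub_mul_pow_le {A q : ℂ} (hA : ‖A‖ ≤ 1) (hq : ‖q‖ < 1) (n : ℕ) :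
    ‖1 - A * q ^ n‖ ≤ 2 := by
  calc ‖1 - A * q ^ n‖ ≤ ‖(1 : ℂ)‖ + ‖A‖ * ‖q‖ ^ n := by
        simpa using norm_sub_le (1 : ℂ) (A * q ^ n)
    _ ≤ 1 + 1 * 1 := by
        rw [norm_one]; gcongr; exact pow_le_one₀ (norm_nonneg _) hq.le
    _ = 2 := by norm_num

theorem exists_norm_sylvesterTerm_le {q : ℂ} (hq : ‖q‖ < 1) :
    ∃ C : ℝ, ∀ A : ℂ, ‖A‖ ≤ 1 → ∀ k, ‖sylvesterTerm A q k‖ ≤ C * ‖q‖ ^ k := by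
  obtain ⟨C, hC0, hC⟩ := exists_norm_sylvester_le hq
  refine ⟨2 * C, fun A hA k => ?_⟩
  have h : sylvesterTerm A q k = (1 - A * q ^ (2 * k)) *
      (qPoch A q k * (-A) ^ k * q ^ (k ^ 2 + k.choose 2) / qPoch q q k) := by
    rw [sylvesterTerm]; ring
  rw [h, norm_mul, mul_assoc 2 C]
  exact mul_le_mul (norm_one_sub_mul_pow_le hA hq _) (hC A hA k) (norm_nonneg _) zero_le_two

theorem summable_sylvesterTerm {A q : ℂ} (hA : ‖A‖ ≤ 1) (hq : ‖q‖ < 1) :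
    Summable (sylvesterTerm A q) := by
  obtain ⟨C, hC⟩ := exists_norm_sylvesterTerm_le hq
  exact .of_norm_bounded ((summable_geometric_of_lt_one (norm_nonneg q) hq).mul_left C) (hC A hA)

theorem sum_sylvesterTerm {q : ℂ} (hq : ‖q‖ < 1) (A : ℂ) (K : ℕ) :
    ∑ k ∈ range K, sylvesterTerm A q k =
      (1 - A) * ∑ k ∈ range K, sylvesterTerm (A * q) q k -
        (1 - q ^ K) * (qPoch A q K * (-A) ^ K * q ^ (K ^ 2 + K.choose 2) / qPoch q q K) := by
  induction K with
  | zero => simp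
  | succ K ih =>
    rw [sum_range_succ, sum_range_succ, ih, mul_add]
    have h := (qPoch_succ' A q K).symm.trans (qPoch_succ A q K)
    have h1 : (1 - A) * sylvesterTerm (A * q) q K = (1 - A * q * q ^ (2 * K)) *
        (qPoch A q K * (1 - A * q ^ K)) * (-(A * q)) ^ K * q ^ (K ^ 2 + K.choose 2) /
          qPoch q q K := by
      rw [← h, sylvesterTerm]; ring
    have hd := qPoch_ne_zero (one_sub_self_mul_pow_ne_zero hq) K
    have hk := one_sub_self_mul_pow_ne_zero hq K
    have e : q ^ ((K + 1) ^ 2) = q ^ (K ^ 2) * (q ^ K) ^ 2 * q := by ring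
    rw [h1, sylvesterTerm, qPoch_succ, qPoch_succ, pow_add q (K ^ 2), pow_add q ((K + 1) ^ 2),
      pow_choose_two_succ, e]
    rw [← neg_mul, mul_pow, pow_mul' q 2 K, pow_succ' q K]
    field_simp
    ring

theorem tsum_sylvesterTerm_eq_mul {A q : ℂ} (hA : ‖A‖ ≤ 1) (hq : ‖q‖ < 1) :
    ∑' k, sylvesterTerm A q k = (1 - A) * ∑' k, sylvesterTerm (A * q) q k := by
  have hAq : ‖A * q‖ ≤ 1 := by
    rw [norm_mul]; exact mul_le_one₀ hA (norm_nonneg _) hq.le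
  have h1 := (summable_sylvesterTerm hA hq).hasSum.tendsto_sum_nat
  have h2 := (summable_sylvesterTerm hAq hq).hasSum.tendsto_sum_nat.const_mul (1 - A)
  obtain ⟨C, hC0, hC⟩ := exists_norm_sylvester_le hq
  have h3 : Tendsto (fun K : ℕ => (1 - q ^ K) *
      (qPoch A q K * (-A) ^ K * q ^ (K ^ 2 + K.choose 2) / qPoch q q K)) atTop (𝓝 0) := by
    have hg : Tendsto (fun K : ℕ => 2 * (C * ‖q‖ ^ K)) atTop (𝓝 0) := by
      simpa using
        ((tendsto_pow_atTop_nhds_zero_of_lt_one (norm_nonneg q) hq).const_mul C).const_mul 2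
    refine squeeze_zero_norm (fun K => ?_) hg
    rw [norm_mul]
    gcongr
    · simpa using norm_one_sub_mul_pow_le (A := 1) (by simp) hq K
    · exact hC A hA K
  have h4 := h2.sub h3
  rw [sub_zero] at h4
  exact tendsto_nhds_unique h1 (h4.congr fun K => (sum_sylvesterTerm hq A K).symm)

theorem norm_mul_pow_le_one {A q : ℂ} (hA : ‖A‖ ≤ 1) (hq : ‖q‖ < 1) (N : ℕ) :
    ‖A * q ^ N‖ ≤ 1 := by
  rw [norm_mul, norm_pow]
  exact mul_le_one₀ hA (by positivity) (pow_le_one₀ (norm_nonneg _) hq.le)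

theorem tsum_sylvesterTerm_eq_qPoch_mul {A q : ℂ} (hA : ‖A‖ ≤ 1) (hq : ‖q‖ < 1) (N : ℕ) :
    ∑' k, sylvesterTerm A q k = qPoch A q N * ∑' k, sylvesterTerm (A * q ^ N) q k := by
  induction N with
  | zero => simp [qPoch_zero]
  | succ N ih =>
    rw [ih, tsum_sylvesterTerm_eq_mul (norm_mul_pow_le_one hA hq N) hq, qPoch_succ, pow_succ]
    ring_nf

/-- Sylvester's identity. -/
theorem tsum_sylvesterTerm {A q : ℂ} (hA : ‖A‖ ≤ 1) (hq : ‖q‖ < 1) :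
    ∑' k, sylvesterTerm A q k = qPochInf A q := by
  obtain ⟨C, hC⟩ := exists_norm_sylvesterTerm_le hq
  have hzero : Tendsto (fun N : ℕ => A * q ^ N) atTop (𝓝 0) := by
    simpa using (tendsto_pow_atTop_nhds_zero_of_norm_lt_one hq).const_mul A
  have hlim : Tendsto (fun N : ℕ => ∑' k, sylvesterTerm (A * q ^ N) q k) atTop
      (𝓝 (∑' k, sylvesterTerm 0 q k)) := by
    refine tendsto_tsum_of_dominated_convergence
      ((summable_geometric_of_lt_one (norm_nonneg q) hq).mul_left C) (fun k => ?_)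
      (Eventually.of_forall fun N k => hC _ (norm_mul_pow_le_one hA hq N) k)
    have hcont : Continuous fun B : ℂ => sylvesterTerm B q k := by
      unfold sylvesterTerm qPoch
      fun_prop
    exact (hcont.tendsto 0).comp hzero
  have h0 : ∑' k, sylvesterTerm 0 q k = 1 := by
    rw [tsum_eq_single 0]
    · simp [sylvesterTerm, qPoch]
    · intro k hk
      simp [sylvesterTerm, hk]
  rw [h0] at hlim
  have h := (tendsto_qPoch A hq).mul hlim
  rw [mul_one] at h
  exact tendsto_nhds_unique
    (tendsto_const_nhds.congr fun N => tsum_sylvesterTerm_eq_qPoch_mul hA hq N) h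

/-- The coefficients expressing the Bailey sequence `α` relative to `a = -1` through
`β_j = 1 / (-q;q)_j`, up to the factor `1 + q ^ (2 * (j + k))`. -/
noncomputable def baileyCoeff (q : ℂ) (j k : ℕ) : ℂ :=
  (-1) ^ k * q ^ k.choose 2 * qPoch (-1) q (2 * j + k) / (qPoch (-1) q (j + 1) * qPoch q q k)

theorem sum_baileyCoeff_partial {q : ℂ} (hq : ‖q‖ < 1) (m K : ℕ) (hK : K ≤ m + 1) :
    (1 + q ^ (m + 1)) * ∑ k ∈ range (K + 1), baileyCoeff q (m + 1 - k) k +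
      q ^ (3 * m + 1) * (1 - q ^ m) * ∑ k ∈ range K, baileyCoeff q (m - k) k =
    (1 + q ^ (2 * m + 1)) * (-1) ^ K * q ^ (K + 1).choose 2 * qPoch (-1) q (m + 1 - K + m) /
      (qPoch (-1) q (m + 1 - K) * qPoch q q K) := by
  have hc := qPoch_ne_zero (one_sub_neg_one_mul_pow_ne_zero hq)
  have hc' := one_add_pow_ne_zero hq
  have hd := qPoch_ne_zero (one_sub_self_mul_pow_ne_zero hq)
  induction K with
  | zero =>
    have h1 := hc m
    have h2 := hc' m
    have h3 := hc' (m + 1)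
    simp only [baileyCoeff, zero_add, sum_range_one, range_zero, sum_empty, mul_zero, add_zero,
      Nat.sub_zero, pow_zero, Nat.choose_zero_succ, Nat.choose_succ_self, qPoch_zero]
    rw [show 2 * (m + 1) = m + 1 + m + 1 by ring, qPoch_succ _ _ (m + 1 + m),
      qPoch_succ _ _ (m + 1), show m + 1 + m = 2 * m + 1 by ring]
    have h4 := hc (m + 1)
    simp only [neg_mul, one_mul, sub_neg_eq_add]
    field_simp
  | succ K ih =>
    obtain ⟨j, rfl⟩ := Nat.exists_eq_add_of_le (Nat.le_of_succ_le_succ hK)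
    have ih := ih (by omega)
    rw [sum_range_succ _ (K + 1), sum_range_succ (fun k => baileyCoeff q (K + j - k) k) K]
    have e1 : K + j + 1 - (K + 1) = j := by omega
    have e2 : K + j + 1 - K = j + 1 := by omega
    have e3 : K + j - K = j := by omega
    rw [e2] at ih
    rw [e1, e3]
    have key : ∀ S S' M M' X Y u v : ℂ, u * S + v * S' = X → X + u * M + v * M' = Y →
        u * (S + M) + v * (S' + M') = Y := by
      intro S S' M M' X Y u v h1 h2
      rw [← h2, ← h1]; ring
    refine key _ _ _ _ _ _ _ _ ih ?_
    have h1 := hc j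
    have h2 := hc' j
    have h3 := hd K
    have h4 := one_sub_pow_succ_ne_zero hq K
    simp only [baileyCoeff]
    rw [show j + 1 + (K + j) = 2 * j + K + 1 by ring, show 2 * j + (K + 1) = 2 * j + K + 1 by ring,
      show j + (K + j) = 2 * j + K by ring, qPoch_succ _ _ (2 * j + K), qPoch_succ _ _ j,
      qPoch_succ _ _ K, ← pow_succ' q K, pow_choose_two_succ q (K + 1), pow_choose_two_succ q K]
    simp only [neg_mul, one_mul, sub_neg_eq_add]
    field_simp
    ring

theorem sum_baileyCoeff_recurrence {q : ℂ} (hq : ‖q‖ < 1) (m : ℕ) :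
    (1 + q ^ (m + 1)) * ∑ k ∈ range (m + 2), baileyCoeff q (m + 1 - k) k +
      q ^ (3 * m + 1) * ((1 - q ^ m) * ∑ k ∈ range (m + 1), baileyCoeff q (m - k) k) =
    (1 + q ^ (2 * m + 1)) * (-1) ^ (m + 1) * q ^ (m + 2).choose 2 * qPoch (-1) q m /
      qPoch q q (m + 1) := by
  have h := sum_baileyCoeff_partial hq m (m + 1) le_rfl
  rw [Nat.sub_self, zero_add, qPoch_zero, one_mul] at h
  rw [← h]; ring

theorem sum_qBinomial_recurrence {q : ℂ} (hq : ‖q‖ < 1) (x : ℂ) (N : ℕ) :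
    (1 - x) * ∑ m ∈ range N, qPoch (-1) q m / qPoch q q m * x ^ m =
      (1 + x) * ∑ m ∈ range N, qPoch (-1) q m / qPoch q q m * (q * x) ^ m -
        qPoch (-1) q N / qPoch q q N * (1 - q ^ N) * x ^ N := by
  induction N with
  | zero => simp
  | succ N ih =>
    have h3 := qPoch_ne_zero (one_sub_self_mul_pow_ne_zero hq) N
    have h4 := one_sub_self_mul_pow_ne_zero hq N
    rw [sum_range_succ, sum_range_succ, mul_add, ih, mul_add, qPoch_succ, qPoch_succ,
      pow_succ' q N, mul_pow]
    field_simp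
    ring

theorem one_sub_mul_sum_baileyCoeff {q : ℂ} (hq0 : q ≠ 0) (hq : ‖q‖ < 1) (n : ℕ) :
    (1 - q ^ n) * ∑ k ∈ range (n + 1), baileyCoeff q (n - k) k =
      -q ^ (n ^ 2 + n.choose 2) *
        ∑ m ∈ range n, qPoch (-1) q m / qPoch q q m * (-(q ^ n)⁻¹) ^ m := by
  induction n with
  | zero => simp
  | succ n ih =>
    have h := sum_baileyCoeff_recurrence hq n
    rw [ih] at h
    have hT := sum_qBinomial_recurrence hq (-(q ^ (n + 1))⁻¹) (n + 1)
    have hx : q * -(q ^ (n + 1))⁻¹ = -(q ^ n)⁻¹ := by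
      rw [pow_succ']; field_simp
    rw [hx,
      sum_range_succ (fun m => qPoch (-1) q m / qPoch q q m * (-(q ^ n)⁻¹) ^ m) n] at hT
    have h3 := qPoch_ne_zero (one_sub_self_mul_pow_ne_zero hq) n
    have h4 := one_sub_pow_succ_ne_zero hq n
    have h5 := one_add_pow_ne_zero hq (n + 1)
    have hp : (-(q ^ n)⁻¹) ^ n = (-1) ^ n * (q ^ (n ^ 2))⁻¹ := by
      rw [neg_pow, inv_pow, ← pow_mul, sq]
    have hp' : (-(q ^ (n + 1))⁻¹) ^ (n + 1) =
        (-1) ^ (n + 1) * (q ^ (n ^ 2) * (q ^ n) ^ 2 * q)⁻¹ := by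
      rw [neg_pow, inv_pow, ← pow_mul]; ring
    have e : q ^ ((n + 1) ^ 2) = q ^ (n ^ 2) * (q ^ n) ^ 2 * q := by ring
    rw [hp, hp', qPoch_succ, qPoch_succ, ← pow_succ' q n] at hT
    rw [qPoch_succ, ← pow_succ' q n, pow_choose_two_succ q (n + 1), pow_choose_two_succ q n] at h
    rw [pow_add q _ (Nat.choose _ _), pow_choose_two_succ q n, e]
    rw [pow_add q _ (Nat.choose _ _)] at h
    generalize ∑ k ∈ range (n + 2), baileyCoeff q (n + 1 - k) k = g at *
    generalize ∑ m ∈ range n, qPoch (-1) q m / qPoch q q m * (-(q ^ n)⁻¹) ^ m = T at *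
    generalize ∑ m ∈ range (n + 1), qPoch (-1) q m / qPoch q q m * (-(q ^ (n + 1))⁻¹) ^ m = T' at *
    have h6 : q ^ n ≠ 0 := pow_ne_zero _ hq0
    have h7 : q ^ n ^ 2 ≠ 0 := pow_ne_zero _ hq0
    apply mul_left_cancel₀ h5
    linear_combination (norm := skip) (1 - q ^ (n + 1)) * h +
      q ^ (n ^ 2) * (q ^ n) ^ 2 * q * (q ^ n * q ^ n.choose 2) * q ^ (n + 1) * hT
    field_simp
    ring

/-- The terms of the double series that is summed by rows and by diagonals. -/
noncomputable def baileyTerm (q : ℂ) (k j : ℕ) : ℂ :=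
  (-1) ^ (j + k) * q ^ ((j + k) ^ 2) * (1 + q ^ (2 * (j + k))) * baileyCoeff q j k

theorem summable_baileyTerm {q : ℂ} (hq : ‖q‖ < 1) :
    Summable (Function.uncurry (baileyTerm q)) := by
  obtain ⟨C, hC0, hC⟩ := exists_norm_inv_qPoch_le hq (one_sub_neg_one_mul_pow_ne_zero hq)
  obtain ⟨D, hD0, hD⟩ := exists_norm_inv_qPoch_le hq (one_sub_self_mul_pow_ne_zero hq)
  have hg := summable_geometric_of_lt_one (norm_nonneg q) hq
  have hgg := hg.mul_of_nonneg hg (fun _ => by positivity) (fun _ => by positivity)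
  refine .of_norm_bounded (hgg.mul_left (2 * (Real.exp (1 - ‖q‖)⁻¹ * (C * D)))) ?_
  rintro ⟨k, j⟩
  have h1 : ‖q‖ ^ ((j + k) ^ 2) ≤ ‖q‖ ^ (k + j) :=
    pow_le_pow_of_le_one (norm_nonneg _) hq.le
      (by rw [add_comm k]; exact Nat.le_self_pow two_ne_zero _)
  have h2 : ‖1 + q ^ (2 * (j + k))‖ ≤ 2 := by
    simpa using norm_one_sub_mul_pow_le (A := -1) (by simp) hq (2 * (j + k))
  have h3 : ‖q‖ ^ k.choose 2 ≤ 1 := pow_le_one₀ (norm_nonneg _) hq.le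
  have h4 := norm_qPoch_le (a := -1) (by simp) hq (2 * j + k)
  have h5 : ‖baileyCoeff q j k‖ ≤ 1 * Real.exp (1 - ‖q‖)⁻¹ * (C * D) := by
    rw [baileyCoeff, div_eq_mul_inv, mul_inv]
    simp only [norm_mul, norm_pow, norm_neg, norm_one, one_pow, one_mul]
    rw [← one_mul (Real.exp _)]
    gcongr
    · exact hC _
    · exact hD _
  rw [Function.uncurry_apply_pair, baileyTerm]
  simp only [norm_mul, norm_pow, norm_neg, norm_one, one_pow, one_mul]
  calc _ ≤ ‖q‖ ^ (k + j) * 2 * (1 * Real.exp (1 - ‖q‖)⁻¹ * (C * D)) := by gcongr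
    _ = _ := by rw [pow_add]; ring

theorem tsum_baileyTerm_row {q : ℂ} (hq : ‖q‖ < 1) (j : ℕ) :
    ∑' k, baileyTerm q k j =
      qPochInf (-q) q * ((-1) ^ j * q ^ (j ^ 2) / qPoch (-q) q j) := by
  have h (k : ℕ) : baileyTerm q k j = (-1) ^ j * q ^ (j ^ 2) * qPoch (-1) q (2 * j) /
      qPoch (-1) q (j + 1) * sylvesterTerm (-1 * q ^ (2 * j)) q k := by
    have e : q ^ ((j + k) ^ 2) = q ^ (j ^ 2) * (q ^ (2 * j)) ^ k * q ^ (k ^ 2) := by ring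
    have e' : (-(-1 * q ^ (2 * j))) ^ k = (q ^ (2 * j)) ^ k := by simp
    have e'' : ((-1 : ℂ) ^ k) ^ 2 = 1 := by rw [← pow_mul, mul_comm, pow_mul]; simp
    rw [baileyTerm, baileyCoeff, sylvesterTerm, qPoch_add, e, e', pow_add (-1 : ℂ), mul_add 2 j k,
      pow_add q (2 * j), pow_add q (k ^ 2)]
    linear_combination (1 + q ^ (2 * j) * q ^ (2 * k)) * (-1) ^ j * q ^ (j ^ 2) *
      (q ^ (2 * j)) ^ k * q ^ (k ^ 2) * q ^ k.choose 2 * (qPoch (-1) q (2 * j) *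
      qPoch (-1 * q ^ (2 * j)) q k) / (qPoch (-1) q (j + 1) * qPoch q q k) * e''
  have h1 := qPochInf_eq_qPoch_mul (-1) hq (2 * j)
  have h2 := qPochInf_eq_qPoch_mul (-1) hq 1
  rw [h1, qPoch_succ, qPoch_zero, pow_one, neg_one_mul q] at h2
  have h3 : qPoch (-1) q (j + 1) = 2 * qPoch (-q) q j := by
    rw [qPoch_succ', neg_one_mul]; norm_num
  have h4 := qPoch_ne_zero (one_sub_neg_one_mul_pow_ne_zero hq) (j + 1)
  rw [h3] at h4
  have h5 := right_ne_zero_of_mul h4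
  simp only [h]
  rw [tsum_mul_left, tsum_sylvesterTerm (norm_mul_pow_le_one (by simp) hq _) hq, h3]
  field_simp
  rw [neg_one_mul] at h2
  linear_combination q ^ (j ^ 2) * h2

theorem sum_antidiagonal_baileyTerm (q : ℂ) (n : ℕ) :
    ∑ p ∈ antidiagonal n, baileyTerm q p.1 p.2 =
      (-1) ^ n * q ^ (n ^ 2) * (1 + q ^ (2 * n)) *
        ∑ k ∈ range (n + 1), baileyCoeff q (n - k) k := by
  rw [Nat.sum_antidiagonal_eq_sum_range_succ (baileyTerm q), mul_sum]
  refine sum_congr rfl fun k hk => ?_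
  rw [baileyTerm, Nat.sub_add_cancel (Nat.le_of_lt_succ (mem_range.mp hk))]

theorem hasSum_antidiagonal {f : ℕ × ℕ → ℂ} (hf : Summable f) :
    HasSum (fun n => ∑ p ∈ antidiagonal n, f p) (∑' p, f p) := by
  have h := HasAntidiagonal.sigmaAntidiagonalEquivProd.hasSum_iff.mpr hf.hasSum
  exact h.sigma fun n => by
    simpa [sum_attach _ f] using hasSum_fintype fun p : antidiagonal n => f p

theorem mul_five_mul_sub_one_div_two (n : ℕ) :
    (n + 1) * (5 * (n + 1) - 1) / 2 = (n + 1) ^ 2 + ((n + 1) ^ 2 + (n + 1).choose 2) := by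
  have h : (n + 1).choose 2 * 2 = (n + 1) * n := by
    induction n with
    | zero => rfl
    | succ n ih => rw [Nat.choose_succ_succ' (n + 1) 1, Nat.choose_one_right, add_mul, ih]; ring
  refine Nat.div_eq_of_eq_mul_left two_pos ?_
  rw [show 5 * (n + 1) - 1 = 5 * n + 4 by omega, add_mul, add_mul _ _ 2, add_mul _ _ 2, h]
  ring

theorem sigma2_hecke_type_ii (q : ℂ) (hq0 : 0 < ‖q‖) (hq1 : ‖q‖ < 1) :
    sigma2 q = (1 / qPochInf (-q) q) *
      (1 - ∑' n : ℕ,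
        (-1 : ℂ) ^ (n + 1) * q ^ ((n + 1) * (5 * (n + 1) - 1) / 2) *
          (1 + q ^ (2 * (n + 1))) / (1 - q ^ (n + 1)) *
        ∑ m ∈ Finset.range (n + 1),
          qPoch (-1) q m / qPoch q q m * (-(q ^ (-((n : ℤ) + 1)))) ^ m) := by
  have hq : q ≠ 0 := norm_pos_iff.mp hq0
  have hP : qPochInf (-q) q ≠ 0 := qPochInf_ne_zero hq1 fun k => by
    simpa [pow_succ'] using one_add_pow_ne_zero hq1 (k + 1)
  have hs := summable_baileyTerm hq1
  have hrow : ∑' p, Function.uncurry (baileyTerm q) p = qPochInf (-q) q * sigma2 q := by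
    rw [hs.tsum_prod]
    simp only [Function.uncurry_apply_pair]
    rw [← hs.tsum_comm, sigma2, ← tsum_mul_left]
    exact tsum_congr fun j => tsum_baileyTerm_row hq1 j
  have hdiag := hasSum_antidiagonal hs
  simp only [Function.uncurry_def, sum_antidiagonal_baileyTerm] at hdiag
  rw [one_div, eq_inv_mul_iff_mul_eq₀ hP, ← hrow, Function.uncurry_def, ← hdiag.tsum_eq,
    hdiag.summable.tsum_eq_zero_add, sub_eq_add_neg, ← tsum_neg]
  congr 1
  · simp [baileyCoeff, qPoch]
  · refine tsum_congr fun n => ?_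
    have h := one_sub_mul_sum_baileyCoeff hq hq1 (n + 1)
    have hz : q ^ (-((n : ℤ) + 1)) = (q ^ (n + 1))⁻¹ := by
      rw [zpow_neg, ← Nat.cast_succ, zpow_natCast]
    have hn := one_sub_pow_succ_ne_zero hq1 n
    rw [mul_comm, ← eq_div_iff hn] at h
    rw [h, hz, mul_five_mul_sub_one_div_two, pow_add q ((n + 1) ^ 2) (_ + _)]
    ring
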